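/- arXiv:1102.1625 — 13 statements merged into one kernel-verified Lean document; each statement's English description precedes it below -/
import Mathlib

section
/- Let α > 0 be real, a ∈ ℤ, f : ℤ → ℝ, and t ∈ ℤ with t ≥ a + 1. Then (∇_a^{−α}(∇f))(t) = ∇(∇_a^{−α} f)(t) − [Γ(t−a+α−1)/(Γ(t−a)·Γ(α))]·f(a); that is, the nabla left fractional sum of the backward difference equals the backward difference of the nabla left fractional sum minus ((t−a)^{overline{α−1}}/Γ(α))·f(a), where x^{overline{ν}} = Γ(x+ν)/Γ(x). -/
/-- Backward difference operator: `(∇ f)(t) = f t − f (t−1)`. -/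
def nablaOp (f : ℤ → ℝ) : ℤ → ℝ := fun t => f t - f (t - 1)

/-- Forward difference operator: `(Δ f)(t) = f (t+1) − f t`. -/
def deltaOp (f : ℤ → ℝ) : ℤ → ℝ := fun t => f (t + 1) - f t

/-- The operator `−Δ`. -/
def negDeltaOp (f : ℤ → ℝ) : ℤ → ℝ := fun t => -(f (t + 1) - f t)

/-- Nabla left fractional sum of order `α` starting at `a`:
`(∇_a^{-α} f)(t) = (1/Γ(α)) Σ_{s=a+1}^{t} [Γ(t−s+α)/Γ(t−s+1)] f(s)`. -/
noncomputable def nablaLeftSum (a : ℤ) (α : ℝ) (f : ℤ → ℝ) : ℤ → ℝ := fun t =>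
  (1 / Real.Gamma α) * ∑ s ∈ Finset.Icc (a + 1) t,
    (Real.Gamma ((t : ℝ) - (s : ℝ) + α) / Real.Gamma ((t : ℝ) - (s : ℝ) + 1)) * f s

/-- Nabla right fractional sum of order `α` ending at `b`:
`(_b∇^{-α} f)(t) = (1/Γ(α)) Σ_{s=t}^{b−1} [Γ(s−t+α)/Γ(s−t+1)] f(s)`. -/
noncomputable def nablaRightSum (b : ℤ) (α : ℝ) (f : ℤ → ℝ) : ℤ → ℝ := fun t =>
  (1 / Real.Gamma α) * ∑ s ∈ Finset.Icc t (b - 1),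
    (Real.Gamma ((s : ℝ) - (t : ℝ) + α) / Real.Gamma ((s : ℝ) - (t : ℝ) + 1)) * f s

theorem stmt0 (α : ℝ) (hα : 0 < α) (a : ℤ) (f : ℤ → ℝ) (t : ℤ) (ht : a + 1 ≤ t) :
    nablaLeftSum a α (nablaOp f) t =
      nablaOp (nablaLeftSum a α f) t -
        (Real.Gamma ((t : ℝ) - (a : ℝ) + α - 1) /
          (Real.Gamma ((t : ℝ) - (a : ℝ)) * Real.Gamma α)) * f a := by
  have shift : ∑ s ∈ Finset.Icc (a + 1) t,
      (Real.Gamma ((t : ℝ) - (s : ℝ) + α) / Real.Gamma ((t : ℝ) - (s : ℝ) + 1)) * f (s - 1) =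
      ∑ s ∈ Finset.Icc a (t - 1),
        (Real.Gamma (((t - 1 : ℤ) : ℝ) - (s : ℝ) + α) /
          Real.Gamma (((t - 1 : ℤ) : ℝ) - (s : ℝ) + 1)) * f s := by
    refine Finset.sum_nbij' (fun s => s - 1) (fun s => s + 1) ?_ ?_ ?_ ?_ ?_
    · intro s hs
      simp only [Finset.mem_Icc] at hs ⊢
      omega
    · intro s hs
      simp only [Finset.mem_Icc] at hs ⊢
      omega
    · intro s _
      ring
    · intro s _
      ring
    · intro s _
      push_cast
      rw [sub_sub_sub_cancel_right]
  have split_first : Finset.Icc a (t - 1) = insert a (Finset.Icc (a + 1) (t - 1)) := by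
    ext s
    simp only [Finset.mem_Icc, Finset.mem_insert]
    omega
  rw [split_first, Finset.sum_insert (by simp)] at shift
  simp only [nablaLeftSum, nablaOp, mul_sub, Finset.sum_sub_distrib, shift]
  push_cast
  rw [show (t : ℝ) - 1 - a + α = t - a + α - 1 by ring,
    show (t : ℝ) - 1 - a + 1 = t - a by ring,
    div_mul_eq_div_div]
  ring
end

section
/- Let α > 0 be a noninteger real number, p ≥ 1 an integer, a ∈ ℤ, f : ℤ → ℝ, and t ∈ ℤ with t ≥ a + 1. Then (∇_a^{−α}(∇^p f))(t) = ∇^p(∇_a^{−α} f)(t) − Σ_{k=0}^{p−1} [Γ(t−a+α−p+k)/(Γ(t−a)·Γ(α+k−p+1))]·(∇^k f)(a). -/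
/-- The coefficient of `z ^ n` in `(1 - z) ^ (-β)`; it vanishes for negative integers `n`. -/
noncomputable def nablaKernel (β : ℝ) (n : ℤ) : ℝ :=
  Real.Gamma (n + β) / (Real.Gamma (n + 1) * Real.Gamma β)

lemma nablaKernel_of_neg (β : ℝ) {n : ℤ} (hn : n < 0) : nablaKernel β n = 0 := by
  obtain ⟨m, hm⟩ := Int.eq_ofNat_of_zero_le (show 0 ≤ -n - 1 by omega)
  have hn' : (n : ℝ) + 1 = -(m : ℝ) := by
    have : n + 1 = -(m : ℤ) := by omega
    exact_mod_cast this
  simp [nablaKernel, hn', Real.Gamma_neg_nat_eq_zero]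

lemma nablaKernel_sub {β : ℝ} (hβ : ∀ m : ℤ, β ≠ m) (n : ℤ) :
    nablaKernel β n - nablaKernel β (n - 1) = nablaKernel (β - 1) n := by
  have hGamma (m : ℤ) : Real.Gamma (m + β) ≠ 0 :=
    Real.Gamma_ne_zero fun k hk => hβ (-k - m) (by push_cast; linarith)
  have h0 : Real.Gamma β ≠ 0 := by simpa using hGamma 0
  have h1 : Real.Gamma (β - 1) ≠ 0 := by simpa [neg_add_eq_sub] using hGamma (-1)
  rcases lt_trichotomy n 0 with hn | rfl | hn
  · rw [nablaKernel_of_neg _ hn, nablaKernel_of_neg _ hn,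
      nablaKernel_of_neg _ (by omega : n - 1 < 0), sub_zero]
  · rw [nablaKernel_of_neg β (by norm_num : (0 : ℤ) - 1 < 0)]
    simp [nablaKernel, h0, h1]
  · have hn0 : (0 : ℝ) < n := by exact_mod_cast hn
    have hβ1 : β - 1 ≠ 0 := by simpa [sub_ne_zero] using hβ 1
    have hnβ : (n : ℝ) + β - 1 ≠ 0 := fun h => hβ (1 - n) (by push_cast; linarith)
    have e0 : Real.Gamma β = (β - 1) * Real.Gamma (β - 1) := by
      simpa using Real.Gamma_add_one hβ1
    have e1 : Real.Gamma (n + β) = (n + β - 1) * Real.Gamma (n + β - 1) := by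
      simpa using Real.Gamma_add_one hnβ
    have hn1 := (Real.Gamma_pos_of_pos hn0).ne'
    have c1 : (n : ℝ) - 1 + β = n + β - 1 := by ring
    have c2 : (n : ℝ) + (β - 1) = n + β - 1 := by ring
    simp only [nablaKernel, Int.cast_sub, Int.cast_one, sub_add_cancel, c1, c2, e0, e1,
      Real.Gamma_add_one hn0.ne']
    field_simp
    ring

lemma nablaLeftSum_eq_sum (a : ℤ) (α : ℝ) (f : ℤ → ℝ) (t : ℤ) :
    nablaLeftSum a α f t = ∑ s ∈ Finset.Icc (a + 1) t, nablaKernel α (t - s) * f s := by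
  simp only [nablaLeftSum, nablaKernel, Finset.mul_sum, Int.cast_sub]
  refine Finset.sum_congr rfl fun s _ => ?_
  ring

lemma nablaLeftSum_nablaOp (a : ℤ) (α : ℝ) (g : ℤ → ℝ) (t : ℤ) :
    nablaLeftSum a α (nablaOp g) t =
      nablaOp (nablaLeftSum a α g) t - nablaKernel α (t - a - 1) * g a := by
  simp only [nablaOp, nablaLeftSum_eq_sum]
  rcases lt_or_ge t (a + 1) with ht | ht
  · rw [Finset.Icc_eq_empty (by omega), Finset.Icc_eq_empty (by omega),
      nablaKernel_of_neg _ (by omega)]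
    simp
  · have hshift : ∑ s ∈ Finset.Icc (a + 1) t, nablaKernel α (t - s) * g (s - 1) =
        ∑ s ∈ Finset.Icc a (t - 1), nablaKernel α (t - 1 - s) * g s := by
      refine Finset.sum_nbij' (· - 1) (· + 1) ?_ ?_ ?_ ?_ ?_
      · intro s hs; simp only [Finset.mem_Icc] at hs ⊢; omega
      · intro s hs; simp only [Finset.mem_Icc] at hs ⊢; omega
      · intro s _; simp
      · intro s _; simp
      · intro s _; simp
    have hsplit : Finset.Icc a (t - 1) = insert a (Finset.Icc (a + 1) (t - 1)) := by
      ext s; simp only [Finset.mem_insert, Finset.mem_Icc]; omega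
    have ha : a ∉ Finset.Icc (a + 1) (t - 1) := by simp
    rw [hsplit, Finset.sum_insert ha] at hshift
    simp only [mul_sub, Finset.sum_sub_distrib, hshift, sub_right_comm t 1 a]
    ring

lemma nablaLeftSum_nablaOp_iterate {α : ℝ} (hα : ∀ m : ℤ, α ≠ m) (p : ℕ) (a : ℤ)
    (f : ℤ → ℝ) (t : ℤ) :
    nablaLeftSum a α (nablaOp^[p] f) t = nablaOp^[p] (nablaLeftSum a α f) t -
      ∑ k ∈ Finset.range p, nablaKernel (α + k - p + 1) (t - a - 1) * (nablaOp^[k] f) a := by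
  induction p generalizing t with
  | zero => simp
  | succ p ih =>
    have hstep (k : ℕ) : nablaKernel (α + k - p + 1) (t - a - 1) -
        nablaKernel (α + k - p + 1) (t - 1 - a - 1) =
          nablaKernel (α + k - (p + 1 : ℕ) + 1) (t - a - 1) := by
      have h := nablaKernel_sub (β := α + k - p + 1)
        (fun m hm => hα (m - k + p - 1) (by push_cast; linarith)) (t - a - 1)
      rw [show t - 1 - a - 1 = t - a - 1 - 1 by ring, h]
      congr 1
      push_cast
      ring
    rw [Function.iterate_succ_apply', Function.iterate_succ_apply', nablaLeftSum_nablaOp,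
      Finset.sum_range_succ, show α + p - (p + 1 : ℕ) + 1 = α by push_cast; ring]
    simp only [← hstep, sub_mul, Finset.sum_sub_distrib]
    rw [nablaOp, ih, ih, nablaOp]
    ring

theorem stmt1 (α : ℝ) (hα : 0 < α) (hαni : ∀ m : ℤ, α ≠ (m : ℝ)) (p : ℕ) (hp : 1 ≤ p)
    (a : ℤ) (f : ℤ → ℝ) (t : ℤ) (ht : a + 1 ≤ t) :
    nablaLeftSum a α (nablaOp^[p] f) t =
      nablaOp^[p] (nablaLeftSum a α f) t -
        ∑ k ∈ Finset.range p,
          (Real.Gamma ((t : ℝ) - (a : ℝ) + α - (p : ℝ) + (k : ℝ)) /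
            (Real.Gamma ((t : ℝ) - (a : ℝ)) * Real.Gamma (α + (k : ℝ) - (p : ℝ) + 1))) *
              (nablaOp^[k] f) a := by
  rw [nablaLeftSum_nablaOp_iterate hαni]
  congr 1
  refine Finset.sum_congr rfl fun k _ => ?_
  simp only [nablaKernel, Int.cast_sub, Int.cast_one, sub_add_cancel]
  congr 3
  ring
end

section
/- Let α > 0 be real, b ∈ ℤ, f : ℤ → ℝ, and t ∈ ℤ with t ≤ b − 1. Then (_b∇^{−α}(−Δf))(t) = −Δ(_b∇^{−α} f)(t) − [Γ(b−t+α−1)/(Γ(b−t)·Γ(α))]·f(b); that is, the nabla right fractional sum of −Δf equals −Δ applied to the nabla right fractional sum of f minus ((b−t)^{overline{α−1}}/Γ(α))·f(b), where x^{overline{ν}} = Γ(x+ν)/Γ(x). -/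
/-- Summing a shifted function from `t` is summing the function itself from `t + 1`, with the
endpoint `b` included. -/
theorem nablaRightSum_comp_add_one (α : ℝ) (b : ℤ) (f : ℤ → ℝ) (t : ℤ) (ht : t ≤ b - 1) :
    nablaRightSum b α (fun s => f (s + 1)) t =
      nablaRightSum b α f (t + 1) +
        (Real.Gamma ((b : ℝ) - (t : ℝ) + α - 1) /
          (Real.Gamma ((b : ℝ) - (t : ℝ)) * Real.Gamma α)) * f b := by
  have hIcc : insert b (Finset.Icc (t + 1) (b - 1)) =
      (Finset.Icc t (b - 1)).map (addRightEmbedding 1) := by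
    rw [Finset.map_add_right_Icc, sub_add_cancel,
      Finset.insert_Icc_sub_one_right_eq_Icc (by lia)]
  have hb : b ∉ Finset.Icc (t + 1) (b - 1) := by simp
  have key : ∑ s ∈ Finset.Icc t (b - 1),
      (Real.Gamma ((s : ℝ) - t + α) / Real.Gamma ((s : ℝ) - t + 1)) * f (s + 1) =
      ∑ s ∈ insert b (Finset.Icc (t + 1) (b - 1)),
        (Real.Gamma ((s : ℝ) - (t + 1 : ℤ) + α) / Real.Gamma ((s : ℝ) - (t + 1 : ℤ) + 1)) *
          f s := by
    rw [hIcc, Finset.sum_map]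
    simp
  rw [Finset.sum_insert hb] at key
  simp only [nablaRightSum]
  rw [key, show (b : ℝ) - (t + 1 : ℤ) + α = b - t + α - 1 by push_cast; ring,
    show (b : ℝ) - (t + 1 : ℤ) + 1 = b - t by push_cast; ring]
  ring

/-- The nabla right fractional sum respects subtraction. -/
theorem nablaRightSum_sub (α : ℝ) (b : ℤ) (f g : ℤ → ℝ) (t : ℤ) :
    nablaRightSum b α (fun s => f s - g s) t = nablaRightSum b α f t - nablaRightSum b α g t := by
  simp only [nablaRightSum, mul_sub, Finset.sum_sub_distrib]

theorem stmt2 (α : ℝ) (hα : 0 < α) (b : ℤ) (f : ℤ → ℝ) (t : ℤ) (ht : t ≤ b - 1) :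
    nablaRightSum b α (negDeltaOp f) t =
      negDeltaOp (nablaRightSum b α f) t -
        (Real.Gamma ((b : ℝ) - (t : ℝ) + α - 1) /
          (Real.Gamma ((b : ℝ) - (t : ℝ)) * Real.Gamma α)) * f b := by
  have hneg : negDeltaOp f = fun s => f s - f (s + 1) := by
    funext s
    simp [negDeltaOp]
  rw [hneg, nablaRightSum_sub, nablaRightSum_comp_add_one α b f t ht, negDeltaOp]
  ring
end

section
/- Let α > 0 be a noninteger real number, p ≥ 1 an integer, b ∈ ℤ, f : ℤ → ℝ, and t ∈ ℤ with t ≤ b − 1. Then (_b∇^{−α}((−Δ)^p f))(t) = (−Δ)^p(_b∇^{−α} f)(t) − Σ_{k=0}^{p−1} [Γ(b−t+α−p+k)/(Γ(b−t)·Γ(α+k−p+1))]·((−Δ)^k f)(b), where (−Δ)^k denotes the k-fold iterate of the operator f ↦ −Δf. -/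
/-- Boundary kernel of the right fractional sum after `j` applications of `-Δ`. -/
noncomputable def boundaryKernel (b : ℤ) (α : ℝ) (j : ℤ) (t : ℤ) : ℝ :=
  Real.Gamma ((b : ℝ) - t + α - j) / (Real.Gamma ((b : ℝ) - t) * Real.Gamma (α - j + 1))

/-- The reciprocal Gamma recursion, valid also at the poles. -/
theorem inv_Gamma_eq_self_mul (x : ℝ) :
    (Real.Gamma x)⁻¹ = x * (Real.Gamma (x + 1))⁻¹ := by
  rcases eq_or_ne x 0 with rfl | hx
  · simp
  · rw [Real.Gamma_add_one hx, mul_inv, mul_inv_cancel_left₀ hx]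

theorem negDeltaOp_boundaryKernel (b : ℤ) {α : ℝ} (hα : ∀ m : ℤ, α ≠ m) (j : ℤ) :
    negDeltaOp (boundaryKernel b α j) = boundaryKernel b α (j + 1) := by
  funext t
  have h₁ : (b : ℝ) - t + α - (j + 1) ≠ 0 := by
    intro h
    apply hα (j + 1 - b + t)
    push_cast
    linarith
  have hnum : Real.Gamma ((b : ℝ) - t + α - j) =
      ((b : ℝ) - t + α - (j + 1)) * Real.Gamma ((b : ℝ) - t + α - (j + 1)) := by
    rw [← Real.Gamma_add_one h₁]
    congr 1
    ring
  have hden := inv_Gamma_eq_self_mul ((b : ℝ) - (t + 1))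
  rw [show (b : ℝ) - (t + 1) + 1 = b - t by ring] at hden
  have hα_inv := inv_Gamma_eq_self_mul (α - j)
  simp only [negDeltaOp, boundaryKernel]
  push_cast
  rw [show (b : ℝ) - (t + 1) + α - j = b - t + α - (j + 1) by ring,
    show α - ((j : ℝ) + 1) + 1 = α - j by ring, hnum]
  simp only [div_eq_mul_inv, mul_inv]
  rw [hden, hα_inv]
  ring

theorem nablaRightSum_negDeltaOp (b : ℤ) (α : ℝ) (f : ℤ → ℝ) (t : ℤ) :
    nablaRightSum b α (negDeltaOp f) t =
      negDeltaOp (nablaRightSum b α f) t - boundaryKernel b α 1 t * f b := by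
  rcases le_or_gt b t with ht | ht
  · have hpole : Real.Gamma ((b : ℝ) - t) = 0 := by
      rw [Real.Gamma_eq_zero_iff]
      refine ⟨(t - b).toNat, ?_⟩
      have : (((t - b).toNat : ℤ) : ℝ) = ((t - b : ℤ) : ℝ) := by
        rw [Int.toNat_of_nonneg (by lia)]
      push_cast at this
      rw [this]
      ring
    simp [nablaRightSum, negDeltaOp, boundaryKernel, hpole,
      Finset.Icc_eq_empty (show ¬ t ≤ b - 1 by lia),
      Finset.Icc_eq_empty (show ¬ t + 1 ≤ b - 1 by lia)]
  · have hshift : ∑ s ∈ Finset.Icc t (b - 1),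
          Real.Gamma ((s : ℝ) - t + α) / Real.Gamma ((s : ℝ) - t + 1) * f (s + 1) =
        ∑ s ∈ Finset.Icc (t + 1) b,
          Real.Gamma ((s : ℝ) - (t + 1) + α) / Real.Gamma ((s : ℝ) - (t + 1) + 1) * f s := by
      refine Finset.sum_nbij' (· + 1) (· - 1) ?_ ?_ ?_ ?_ ?_ <;>
        simp only [Finset.mem_Icc]
      · lia
      · lia
      · lia
      · lia
      · intro s _
        push_cast
        simp only [add_sub_add_right_eq_sub]
    have hIcc : Finset.Icc (t + 1) b = insert b (Finset.Icc (t + 1) (b - 1)) := by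
      ext s
      simp only [Finset.mem_Icc, Finset.mem_insert]
      lia
    rw [hIcc, Finset.sum_insert (by simp)] at hshift
    simp only [nablaRightSum, negDeltaOp, boundaryKernel]
    push_cast
    simp only [neg_sub, mul_sub, Finset.sum_sub_distrib, hshift]
    rw [show (b : ℝ) - (t + 1) + α = b - t + α - 1 by ring,
      show (b : ℝ) - (t + 1) + 1 = b - t by ring, show α - 1 + 1 = α by ring]
    simp only [div_eq_mul_inv, mul_inv]
    ring

theorem nablaRightSum_iterate_negDeltaOp (b : ℤ) {α : ℝ} (hα : ∀ m : ℤ, α ≠ m) (p : ℕ)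
    (f : ℤ → ℝ) (t : ℤ) :
    nablaRightSum b α (negDeltaOp^[p] f) t =
      negDeltaOp^[p] (nablaRightSum b α f) t -
        ∑ k ∈ Finset.range p, boundaryKernel b α (p - k) t * (negDeltaOp^[k] f) b := by
  induction p generalizing t with
  | zero => simp
  | succ p ih =>
    have hkernel (k : ℕ) : boundaryKernel b α ((p + 1 : ℕ) - k) t =
        boundaryKernel b α (p - k) t - boundaryKernel b α (p - k) (t + 1) := by
      rw [show ((p + 1 : ℕ) : ℤ) - k = p - k + 1 by push_cast; ring,
        ← negDeltaOp_boundaryKernel b hα]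
      simp [negDeltaOp]
    have hlast : ((p + 1 : ℕ) : ℤ) - p = 1 := by push_cast; ring
    rw [Finset.sum_range_succ, hlast]
    simp only [Function.iterate_succ_apply', hkernel, sub_mul, Finset.sum_sub_distrib]
    rw [nablaRightSum_negDeltaOp]
    simp only [negDeltaOp] at ih ⊢
    rw [ih, ih]
    ring

theorem stmt3 (α : ℝ) (hα : 0 < α) (hαni : ∀ m : ℤ, α ≠ (m : ℝ)) (p : ℕ) (hp : 1 ≤ p)
    (b : ℤ) (f : ℤ → ℝ) (t : ℤ) (ht : t ≤ b - 1) :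
    nablaRightSum b α (negDeltaOp^[p] f) t =
      negDeltaOp^[p] (nablaRightSum b α f) t -
        ∑ k ∈ Finset.range p,
          (Real.Gamma ((b : ℝ) - (t : ℝ) + α - (p : ℝ) + (k : ℝ)) /
            (Real.Gamma ((b : ℝ) - (t : ℝ)) * Real.Gamma (α + (k : ℝ) - (p : ℝ) + 1))) *
              (negDeltaOp^[k] f) b := by
  rw [nablaRightSum_iterate_negDeltaOp b hαni]
  congr 1
  refine Finset.sum_congr rfl fun k _ => ?_
  simp only [boundaryKernel]
  push_cast
  rw [show (b : ℝ) - t + α - (p - k) = b - t + α - p + k by ring,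
    show α - ((p : ℝ) - k) + 1 = α + k - p + 1 by ring]
end

section
/- Let n ≥ 1 be an integer, b ∈ ℤ, f : ℤ → ℝ, and t ∈ ℤ with t ≤ b − 1. Then ((−Δ)^n(_b∇^{−n} f))(t) = f(t); that is, the n-fold iterate of −Δ applied to the nabla right fractional sum of integer order n recovers f on {…, b−2, b−1}. -/
theorem sum_Icc_eq_add_sum_Icc_succ {t c : ℤ} (h : t ≤ c) (g : ℤ → ℝ) :
    ∑ s ∈ Finset.Icc t c, g s = g t + ∑ s ∈ Finset.Icc (t + 1) c, g s := by
  rw [← Finset.insert_Icc_add_one_left_eq_Icc h, Finset.sum_insert (by simp)]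

/-- Pascal's rule for the kernel of the fractional sum. -/
theorem fractionalKernel_sub {α k : ℝ} (hα : 0 < α) (hk : 0 < k) :
    1 / Real.Gamma (α + 1) * (Real.Gamma (k + (α + 1)) / Real.Gamma (k + 1)) -
      1 / Real.Gamma (α + 1) * (Real.Gamma (k - 1 + (α + 1)) / Real.Gamma (k - 1 + 1)) =
    1 / Real.Gamma α * (Real.Gamma (k + α) / Real.Gamma (k + 1)) := by
  have hΓα := (Real.Gamma_pos_of_pos hα).ne'
  have hΓk := (Real.Gamma_pos_of_pos hk).ne'
  rw [show k + (α + 1) = k + α + 1 by ring, show k - 1 + (α + 1) = k + α by ring,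
    show k - 1 + 1 = k by ring, Real.Gamma_add_one hα.ne', Real.Gamma_add_one hk.ne',
    Real.Gamma_add_one (add_pos hk hα).ne']
  field_simp
  ring

theorem nablaRightSum_of_le {b t : ℤ} (h : b ≤ t) (α : ℝ) (f : ℤ → ℝ) :
    nablaRightSum b α f t = 0 := by
  simp [nablaRightSum, Finset.Icc_eq_empty (show ¬ t ≤ b - 1 by lia)]

theorem nablaRightSum_of_lt {b t : ℤ} (h : t < b) {α : ℝ} (hα : 0 < α) (f : ℤ → ℝ) :
    nablaRightSum b α f t = f t + ∑ s ∈ Finset.Icc (t + 1) (b - 1),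
      1 / Real.Gamma α * (Real.Gamma (s - t + α) / Real.Gamma (s - t + 1)) * f s := by
  have hΓα := (Real.Gamma_pos_of_pos hα).ne'
  rw [nablaRightSum, sum_Icc_eq_add_sum_Icc_succ (by lia), mul_add, Finset.mul_sum]
  simp [hΓα, mul_assoc]

theorem negDeltaOp_nablaRightSum_add_one (b : ℤ) {α : ℝ} (hα : 0 < α) (f : ℤ → ℝ) :
    negDeltaOp (nablaRightSum b (α + 1) f) = nablaRightSum b α f := by
  funext t
  rcases lt_or_ge t b with h | h
  · rw [negDeltaOp, nablaRightSum_of_lt h (by linarith), nablaRightSum_of_lt h hα, neg_sub,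
      add_sub_assoc, nablaRightSum, Finset.mul_sum, ← Finset.sum_sub_distrib]
    congr 1
    refine Finset.sum_congr rfl fun s hs => ?_
    have hk : (0 : ℝ) < s - t := by
      have : t < s := by have := (Finset.mem_Icc.mp hs).1; lia
      exact sub_pos.mpr (by exact_mod_cast this)
    rw [← fractionalKernel_sub hα hk, Int.cast_add, Int.cast_one, ← sub_sub]
    ring
  · rw [negDeltaOp, nablaRightSum_of_le h, nablaRightSum_of_le (by lia : b ≤ t + 1),
      nablaRightSum_of_le h]
    simp

theorem negDeltaOp_nablaRightSum_one {b t : ℤ} (h : t < b) (f : ℤ → ℝ) :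
    negDeltaOp (nablaRightSum b 1 f) t = f t := by
  have hK : ∀ u, nablaRightSum b 1 f u = ∑ s ∈ Finset.Icc u (b - 1), f s := by
    intro u
    rw [nablaRightSum, Real.Gamma_one, div_one, one_mul]
    refine Finset.sum_congr rfl fun s hs => ?_
    have hk : (0 : ℝ) ≤ s - u := sub_nonneg.mpr (by exact_mod_cast (Finset.mem_Icc.mp hs).1)
    rw [div_self (Real.Gamma_pos_of_pos (by linarith)).ne', one_mul]
  rw [negDeltaOp, hK, hK, sum_Icc_eq_add_sum_Icc_succ (by lia : t ≤ b - 1)]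
  ring

theorem negDeltaOp_iterate_nablaRightSum (b : ℤ) (m : ℕ) (f : ℤ → ℝ) :
    negDeltaOp^[m] (nablaRightSum b (m + 1) f) = nablaRightSum b 1 f := by
  induction m with
  | zero => simp
  | succ m ih =>
    rw [Function.iterate_succ_apply, negDeltaOp_nablaRightSum_add_one b (by positivity)]
    push_cast
    exact ih

theorem stmt4 (n : ℕ) (hn : 1 ≤ n) (b : ℤ) (f : ℤ → ℝ) (t : ℤ) (ht : t ≤ b - 1) :
    negDeltaOp^[n] (nablaRightSum b (n : ℝ) f) t = f t := by
  obtain ⟨m, rfl⟩ := Nat.exists_eq_add_of_le' hn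
  rw [Function.iterate_succ_apply', Nat.cast_succ, negDeltaOp_iterate_nablaRightSum]
  exact negDeltaOp_nablaRightSum_one (by lia) f
end

section
/- Let α > 0 and μ > −1 be real, and let b, t ∈ ℤ with t ≤ b − 1. Then (1/Γ(α)) Σ_{s=t}^{b−1} [Γ(s−t+α)/Γ(s−t+1)]·[Γ(b−s+μ)/Γ(b−s)] = [Γ(μ+1)/Γ(α+μ+1)]·[Γ(b−t+α+μ)/Γ(b−t)]; that is, the nabla right fractional sum of order α of the function t ↦ (b−t)^{overline{μ}} equals (Γ(μ+1)/Γ(α+μ+1))·(b−t)^{overline{α+μ}}, where x^{overline{ν}} = Γ(x+ν)/Γ(x). -/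
theorem gamma_nat_add_eq_mul_ascPochhammer {x : ℝ} (hx : 0 < x) (k : ℕ) :
    Real.Gamma (k + x) = Real.Gamma x * (ascPochhammer ℝ k).eval x := by
  induction k with
  | zero => simp
  | succ k ih =>
    rw [ascPochhammer_succ_eval, ← mul_assoc, ← ih, Nat.cast_succ, add_right_comm,
      Real.Gamma_add_one (by positivity)]
    ring

theorem gamma_nat_add_eq_mul_multichoose {x : ℝ} (hx : 0 < x) (k : ℕ) :
    Real.Gamma (k + x) / Real.Gamma (k + 1) = Real.Gamma x * Ring.multichoose x k := by
  have h := Ring.factorial_nsmul_multichoose_eq_ascPochhammer x k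
  rw [Polynomial.ascPochhammer_smeval_eq_eval, nsmul_eq_mul] at h
  rw [gamma_nat_add_eq_mul_ascPochhammer hx, Real.Gamma_nat_eq_factorial, ← h]
  field_simp

theorem sum_multichoose_mul_multichoose {R : Type*} [CommRing R] [BinomialRing R]
    (x y : R) (n : ℕ) :
    ∑ k ∈ Finset.range (n + 1), Ring.multichoose x k * Ring.multichoose y (n - k) =
      Ring.multichoose (x + y) n := by
  have key (r : R) (k : ℕ) : Ring.multichoose r k = (-1) ^ k * Ring.choose (-r) k := by
    rw [Ring.choose_neg']
    simp [Units.smul_def, ← mul_assoc, ← mul_pow]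
  rw [key (x + y), neg_add, Ring.add_choose_eq n (Commute.all _ _),
    Finset.Nat.sum_antidiagonal_eq_sum_range_succ
      (fun i j => Ring.choose (-x) i * Ring.choose (-y) j), Finset.mul_sum]
  refine Finset.sum_congr rfl fun k hk => ?_
  have hkn : k ≤ n := Nat.le_of_lt_succ (Finset.mem_range.mp hk)
  rw [key x, key y]
  nth_rewrite 3 [← Nat.add_sub_cancel' hkn]
  rw [pow_add]
  ring

theorem stmt6 (α μ : ℝ) (hα : 0 < α) (hμ : -1 < μ) (b t : ℤ) (ht : t ≤ b - 1) :
    (1 / Real.Gamma α) * ∑ s ∈ Finset.Icc t (b - 1),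
        (Real.Gamma ((s : ℝ) - (t : ℝ) + α) / Real.Gamma ((s : ℝ) - (t : ℝ) + 1)) *
          (Real.Gamma ((b : ℝ) - (s : ℝ) + μ) / Real.Gamma ((b : ℝ) - (s : ℝ))) =
      (Real.Gamma (μ + 1) / Real.Gamma (α + μ + 1)) *
        (Real.Gamma ((b : ℝ) - (t : ℝ) + α + μ) / Real.Gamma ((b : ℝ) - (t : ℝ))) := by
  obtain ⟨n, rfl⟩ : ∃ n : ℕ, b = t + n + 1 := ⟨(b - 1 - t).toNat, by omega⟩
  have hμ' : 0 < μ + 1 := by linarith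
  have hsum : 0 < α + (μ + 1) := by linarith
  have hIcc : Finset.Icc t (t + n + 1 - 1) =
      (Finset.range (n + 1)).image (fun k : ℕ => t + k) := by
    ext s
    simp only [Finset.mem_Icc, Finset.mem_image, Finset.mem_range]
    constructor
    · intro h
      exact ⟨(s - t).toNat, by omega, by omega⟩
    · rintro ⟨k, hk, rfl⟩
      omega
  have hterm : ∀ k ∈ Finset.range (n + 1),
      (Real.Gamma (((t + k : ℤ) : ℝ) - t + α) / Real.Gamma (((t + k : ℤ) : ℝ) - t + 1)) *
        (Real.Gamma (((t + n + 1 : ℤ) : ℝ) - ((t + k : ℤ) : ℝ) + μ) /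
          Real.Gamma (((t + n + 1 : ℤ) : ℝ) - ((t + k : ℤ) : ℝ))) =
      Real.Gamma α * Real.Gamma (μ + 1) *
        (Ring.multichoose α k * Ring.multichoose (μ + 1) (n - k)) := by
    intro k hk
    have hkn : k ≤ n := Nat.le_of_lt_succ (Finset.mem_range.mp hk)
    have h₁ := gamma_nat_add_eq_mul_multichoose hα k
    have h₂ := gamma_nat_add_eq_mul_multichoose hμ' (n - k)
    rw [Nat.cast_sub hkn] at h₂
    rw [mul_mul_mul_comm, ← h₁, ← h₂]
    push_cast
    ring_nf
  rw [hIcc, Finset.sum_image (by intro i _ j _ h; simpa using h), Finset.sum_congr rfl hterm,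
    ← Finset.mul_sum, sum_multichoose_mul_multichoose]
  have h := gamma_nat_add_eq_mul_multichoose hsum n
  have e₁ : ((t + n + 1 : ℤ) : ℝ) - t + α + μ = n + (α + (μ + 1)) := by push_cast; ring
  have e₂ : ((t + n + 1 : ℤ) : ℝ) - t = n + 1 := by push_cast; ring
  rw [e₁, e₂, h, add_assoc α μ 1]
  have := (Real.Gamma_pos_of_pos hα).ne'
  have := (Real.Gamma_pos_of_pos hsum).ne'
  field_simp
end

section
/- Let α > 0 and μ > −1 be real, and let a, t ∈ ℤ with t ≥ a + 1. Then (1/Γ(α)) Σ_{s=a+1}^{t} [Γ(t−s+α)/Γ(t−s+1)]·[Γ(s−a+μ)/Γ(s−a)] = [Γ(μ+1)/Γ(α+μ+1)]·[Γ(t−a+α+μ)/Γ(t−a)]; that is, the nabla left fractional sum of order α of the function t ↦ (t−a)^{overline{μ}} equals (Γ(μ+1)/Γ(α+μ+1))·(t−a)^{overline{α+μ}}, where x^{overline{ν}} = Γ(x+ν)/Γ(x). -/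
open Finset in
/-- If `c` and `d` satisfy the recurrences of rising-factorial binomial coefficients with
parameters `α` and `β`, their Cauchy product satisfies the one with parameter `α + β`. -/
theorem succ_mul_sum_antidiagonal_succ {R : Type*} [CommRing R] {α β : R} {c d : ℕ → R}
    (hc : ∀ n : ℕ, ((n : R) + 1) * c (n + 1) = (n + α) * c n)
    (hd : ∀ n : ℕ, ((n : R) + 1) * d (n + 1) = (n + β) * d n) (n : ℕ) :
    ((n : R) + 1) * ∑ p ∈ antidiagonal (n + 1), c p.1 * d p.2 =
      (n + (α + β)) * ∑ p ∈ antidiagonal n, c p.1 * d p.2 := by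
  have hsplit : ((n : R) + 1) * ∑ p ∈ antidiagonal (n + 1), c p.1 * d p.2 =
      ∑ p ∈ antidiagonal (n + 1), (p.1 : R) * c p.1 * d p.2 +
        ∑ p ∈ antidiagonal (n + 1), c p.1 * ((p.2 : R) * d p.2) := by
    rw [mul_sum, ← sum_add_distrib]
    refine sum_congr rfl fun p hp => ?_
    have h : (p.1 : R) + p.2 = n + 1 := by
      simpa using congrArg (Nat.cast : ℕ → R) (mem_antidiagonal.1 hp)
    rw [← h]
    ring
  rw [hsplit, Nat.sum_antidiagonal_succ, Nat.sum_antidiagonal_succ']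
  simp only [Nat.cast_zero, Nat.cast_add, Nat.cast_one, zero_mul, mul_zero, zero_add, hc, hd]
  rw [mul_sum, ← sum_add_distrib]
  refine sum_congr rfl fun p hp => ?_
  have h : (p.1 : R) + p.2 = n := by
      simpa using congrArg (Nat.cast : ℕ → R) (mem_antidiagonal.1 hp)
  rw [← h]
  ring

theorem succ_mul_Gamma_div_Gamma {α : ℝ} (hα : 0 < α) (n : ℕ) :
    ((n : ℝ) + 1) * (Real.Gamma ((n + 1 : ℕ) + α) / Real.Gamma ((n + 1 : ℕ) + 1)) =
      (n + α) * (Real.Gamma (n + α) / Real.Gamma (n + 1)) := by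
  have hn : (n : ℝ) + 1 ≠ 0 := by positivity
  have hG : Real.Gamma ((n : ℝ) + 1) ≠ 0 := (Real.Gamma_pos_of_pos (by positivity)).ne'
  rw [show (((n + 1 : ℕ) : ℝ) + α) = (n + α) + 1 by push_cast; ring, Nat.cast_succ,
    Real.Gamma_add_one (by positivity : (n : ℝ) + α ≠ 0), Real.Gamma_add_one hn]
  field_simp

open Finset in
theorem sum_antidiagonal_Gamma_div_mul_Gamma_div {α β : ℝ} (hα : 0 < α) (hβ : 0 < β) (n : ℕ) :
    ∑ p ∈ antidiagonal n, Real.Gamma (p.1 + α) / Real.Gamma (p.1 + 1) *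
        (Real.Gamma (p.2 + β) / Real.Gamma (p.2 + 1)) =
      Real.Gamma α * Real.Gamma β / Real.Gamma (α + β) *
        (Real.Gamma (n + (α + β)) / Real.Gamma (n + 1)) := by
  induction n with
  | zero =>
    have h : Real.Gamma (α + β) ≠ 0 := (Real.Gamma_pos_of_pos (by positivity)).ne'
    simp [h]
  | succ n ih =>
    have hn : (n : ℝ) + 1 ≠ 0 := by positivity
    have h := succ_mul_sum_antidiagonal_succ
      (c := fun n : ℕ => Real.Gamma (n + α) / Real.Gamma (n + 1))
      (d := fun n : ℕ => Real.Gamma (n + β) / Real.Gamma (n + 1))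
      (succ_mul_Gamma_div_Gamma hα) (succ_mul_Gamma_div_Gamma hβ) n
    apply mul_left_cancel₀ hn
    rw [h, ih, mul_left_comm, ← succ_mul_Gamma_div_Gamma (add_pos hα hβ), mul_left_comm]

theorem stmt7 (α μ : ℝ) (hα : 0 < α) (hμ : -1 < μ) (a t : ℤ) (ht : a + 1 ≤ t) :
    (1 / Real.Gamma α) * ∑ s ∈ Finset.Icc (a + 1) t,
        (Real.Gamma ((t : ℝ) - (s : ℝ) + α) / Real.Gamma ((t : ℝ) - (s : ℝ) + 1)) *
          (Real.Gamma ((s : ℝ) - (a : ℝ) + μ) / Real.Gamma ((s : ℝ) - (a : ℝ))) =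
      (Real.Gamma (μ + 1) / Real.Gamma (α + μ + 1)) *
        (Real.Gamma ((t : ℝ) - (a : ℝ) + α + μ) / Real.Gamma ((t : ℝ) - (a : ℝ))) := by
  obtain ⟨n, rfl⟩ : ∃ n : ℕ, t = a + 1 + n := Int.le.dest ht |>.imp fun _ h => h.symm
  have hGα : Real.Gamma α ≠ 0 := (Real.Gamma_pos_of_pos hα).ne'
  have hsum : ∑ s ∈ Finset.Icc (a + 1) (a + 1 + n),
      (Real.Gamma (((a + 1 + n : ℤ) : ℝ) - (s : ℝ) + α) /
          Real.Gamma (((a + 1 + n : ℤ) : ℝ) - (s : ℝ) + 1)) *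
        (Real.Gamma ((s : ℝ) - (a : ℝ) + μ) / Real.Gamma ((s : ℝ) - (a : ℝ))) =
      ∑ p ∈ Finset.HasAntidiagonal.antidiagonal n, Real.Gamma (p.1 + α) / Real.Gamma (p.1 + 1) *
        (Real.Gamma (p.2 + (μ + 1)) / Real.Gamma (p.2 + 1)) := by
    symm
    refine Finset.sum_bij' (fun p _ => a + 1 + (p.2 : ℤ))
      (fun s _ => ((a + 1 + n - s).toNat, (s - (a + 1)).toNat)) ?_ ?_ ?_ ?_ ?_
    · intro p hp
      have := Finset.HasAntidiagonal.mem_antidiagonal.1 hp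
      rw [Finset.mem_Icc]
      omega
    · intro s hs
      rw [Finset.mem_Icc] at hs
      rw [Finset.HasAntidiagonal.mem_antidiagonal]
      omega
    · intro p hp
      have := Finset.HasAntidiagonal.mem_antidiagonal.1 hp
      ext <;> dsimp only <;> omega
    · intro s hs
      rw [Finset.mem_Icc] at hs
      dsimp only
      omega
    · intro p hp
      have h : (p.1 : ℝ) + p.2 = n := by exact_mod_cast Finset.HasAntidiagonal.mem_antidiagonal.1 hp
      push_cast
      rw [← h]
      congr 3 <;> ring_nf
  rw [hsum, sum_antidiagonal_Gamma_div_mul_Gamma_div hα (by linarith : 0 < μ + 1)]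
  push_cast
  rw [show (a : ℝ) + 1 + n - a + α + μ = n + (α + (μ + 1)) by ring,
    show (a : ℝ) + 1 + n - a = n + 1 by ring, ← add_assoc α μ 1]
  field_simp
end

section
/- Let α > 0 be a noninteger real number, n = ⌊α⌋ + 1, b ∈ ℤ, f : ℤ → ℝ, and t ∈ ℤ with t ≤ b − 1. Then (_b∇^{−α}(^C_b∇^{α} f))(t) = f(t) − Σ_{k=0}^{n−1} [Γ(b−t+k)/(Γ(b−t)·k!)]·((−Δ)^k f)(b), where (−Δ)^k denotes the k-fold iterate of f ↦ −Δf. In particular, if 0 < α < 1 then (_b∇^{−α}(^C_b∇^{α} f))(t) = f(t) − f(b). -/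
section RightSumSeries

open PowerSeries

/-- The power series `(1 - X) ^ (-r)`. -/
noncomputable def multichooseSeries (r : ℝ) : PowerSeries ℝ :=
  PowerSeries.mk (Ring.multichoose r)

/-- The values of `f` to the left of `b`, read backwards, as a power series. -/
noncomputable def reverseSeries (b : ℤ) (f : ℤ → ℝ) : PowerSeries ℝ :=
  PowerSeries.mk fun m => f (b - 1 - m)

lemma multichooseSeries_eq_rescale (r : ℝ) :
    multichooseSeries r = rescale (-1 : ℝ) (binomialSeries ℝ (-r)) := by
  ext m
  rw [multichooseSeries, coeff_mk, coeff_rescale, binomialSeries_coeff, Ring.choose_neg',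
    smul_eq_mul, mul_one, Units.smul_def, zsmul_eq_mul, ← mul_assoc]
  simp [← mul_pow]

lemma multichooseSeries_add (r s : ℝ) :
    multichooseSeries (r + s) = multichooseSeries r * multichooseSeries s := by
  simp only [multichooseSeries_eq_rescale, neg_add, binomialSeries_add, map_mul]

lemma multichooseSeries_zero : multichooseSeries 0 = 1 := by
  rw [multichooseSeries_eq_rescale, neg_zero, binomialSeries_zero, map_one]

lemma multichooseSeries_one_mul_one_sub_X : multichooseSeries 1 * (1 - X) = 1 := by
  have h : multichooseSeries 1 = PowerSeries.mk 1 := by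
    ext m
    simp [multichooseSeries]
  rw [h, mk_one_mul_one_sub_eq_one]

lemma Gamma_add_natCast {r : ℝ} (hr : 0 < r) (m : ℕ) :
    Real.Gamma (m + r) = Real.Gamma r * (m.factorial * Ring.multichoose r m) := by
  rw [← nsmul_eq_mul, Ring.factorial_nsmul_multichoose_eq_ascPochhammer,
    Polynomial.ascPochhammer_smeval_eq_eval]
  induction m with
  | zero => simp
  | succ m ih =>
    have h : (m : ℝ) + r ≠ 0 := by positivity
    rw [ascPochhammer_succ_eval, Nat.cast_succ, add_right_comm, Real.Gamma_add_one h, ih]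
    ring

lemma Gamma_div_Gamma_eq_multichoose {r : ℝ} (hr : 0 < r) (m : ℕ) :
    Real.Gamma (m + r) / (Real.Gamma r * Real.Gamma (m + 1)) = Ring.multichoose r m := by
  have h := (Real.Gamma_pos_of_pos hr).ne'
  rw [Gamma_add_natCast hr, Real.Gamma_nat_eq_factorial]
  field_simp

lemma reverseSeries_nablaRightSum (b : ℤ) {r : ℝ} (hr : 0 < r) (f : ℤ → ℝ) :
    reverseSeries b (nablaRightSum b r f) = multichooseSeries r * reverseSeries b f := by
  ext m
  rw [coeff_mul, Finset.Nat.sum_antidiagonal_eq_sum_range_succ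
    (fun i j => coeff i (multichooseSeries r) * coeff j (reverseSeries b f))]
  simp only [reverseSeries, multichooseSeries, coeff_mk, nablaRightSum, Finset.mul_sum]
  symm
  refine Finset.sum_bij (fun i _ => b - 1 - m + i) ?_ ?_ ?_ ?_
  · intro i hi
    rw [Finset.mem_range] at hi
    rw [Finset.mem_Icc]
    omega
  · intro i _ j _ h
    omega
  · intro s hs
    rw [Finset.mem_Icc] at hs
    refine ⟨(s - (b - 1 - m)).toNat, ?_, ?_⟩
    · rw [Finset.mem_range]
      omega
    · omega
  · intro i hi
    rw [Finset.mem_range] at hi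
    have hc : b - 1 - ((m - i : ℕ) : ℤ) = b - 1 - m + i := by omega
    have hs : ((b - 1 - m + i : ℤ) : ℝ) - ((b - 1 - m : ℤ) : ℝ) = i := by
      push_cast
      ring
    rw [hc, hs, ← Gamma_div_Gamma_eq_multichoose hr]
    have h := (Real.Gamma_pos_of_pos hr).ne'
    have h' := (Real.Gamma_pos_of_pos (by positivity : (0 : ℝ) < i + 1)).ne'
    field_simp

lemma reverseSeries_negDeltaOp (b : ℤ) (f : ℤ → ℝ) :
    reverseSeries b (negDeltaOp f) = (1 - X) * reverseSeries b f - C (f b) := by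
  ext m
  cases m with
  | zero => simp [reverseSeries, negDeltaOp, sub_mul]
  | succ m =>
    have h : b - 1 - ((m : ℤ) + 1) + 1 = b - 1 - m := by ring
    simp [reverseSeries, negDeltaOp, sub_mul, coeff_succ_X_mul, h]

lemma multichooseSeries_mul_reverseSeries_iterate (b : ℤ) (f : ℤ → ℝ) (n : ℕ) :
    multichooseSeries n * reverseSeries b (negDeltaOp^[n] f) =
      reverseSeries b f -
        ∑ k ∈ Finset.range n, multichooseSeries (k + 1) * C ((negDeltaOp^[k] f) b) := by
  induction n with
  | zero => simp [multichooseSeries_zero]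
  | succ n ih =>
    have h : multichooseSeries ((n : ℝ) + 1) * (1 - X) = multichooseSeries n := by
      rw [multichooseSeries_add, mul_assoc, multichooseSeries_one_mul_one_sub_X, mul_one]
    rw [Finset.sum_range_succ, ← sub_sub, ← ih, Function.iterate_succ_apply',
      reverseSeries_negDeltaOp, Nat.cast_succ, mul_sub, ← mul_assoc, h]

lemma neg_one_pow_mul_deltaOp_iterate (f : ℤ → ℝ) (n : ℕ) :
    (fun s => (-1 : ℝ) ^ n * deltaOp^[n] f s) = negDeltaOp^[n] f := by
  induction n with
  | zero => simp
  | succ n ih =>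
    rw [Function.iterate_succ_apply' negDeltaOp, ← ih]
    ext s
    rw [Function.iterate_succ_apply']
    simp only [deltaOp, negDeltaOp]
    ring

lemma nablaRightSum_caputo {α : ℝ} (hα : 0 < α) {n : ℕ} (hn : α < n) (b : ℤ) (f : ℤ → ℝ)
    {t : ℤ} (ht : t ≤ b - 1) :
    nablaRightSum b α
        (nablaRightSum b ((n : ℝ) - α) (fun s => (-1 : ℝ) ^ n * deltaOp^[n] f s)) t =
      f t - ∑ k ∈ Finset.range n,
          (Real.Gamma ((b : ℝ) - (t : ℝ) + (k : ℝ)) /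
            (Real.Gamma ((b : ℝ) - (t : ℝ)) * (Nat.factorial k : ℝ))) * (negDeltaOp^[k] f) b := by
  obtain ⟨m, hm⟩ := Int.eq_ofNat_of_zero_le (sub_nonneg.mpr ht)
  obtain rfl : t = b - 1 - m := by omega
  have h := multichooseSeries_mul_reverseSeries_iterate b f n
  rw [← add_sub_cancel α (n : ℝ), multichooseSeries_add, mul_assoc,
    ← reverseSeries_nablaRightSum b (sub_pos.mpr hn), ← reverseSeries_nablaRightSum b hα,
    ← neg_one_pow_mul_deltaOp_iterate] at h
  replace h := congrArg (coeff m) h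
  simp only [map_sub, map_sum, coeff_mul_C, reverseSeries, multichooseSeries, coeff_mk] at h
  rw [h]
  congr 1
  refine Finset.sum_congr rfl fun k _ => ?_
  rw [← Gamma_div_Gamma_eq_multichoose (by positivity), Real.Gamma_nat_eq_factorial k,
    mul_comm (k.factorial : ℝ)]
  have hb : (b : ℝ) - ((b - 1 - m : ℤ) : ℝ) = m + 1 := by
    push_cast
    ring
  rw [hb, add_right_comm (m : ℝ) 1, add_assoc]

end RightSumSeries

theorem stmt12 (α : ℝ) (hα : 0 < α) (hαni : ∀ m : ℤ, α ≠ (m : ℝ)) (n : ℕ)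
    (hn : (n : ℤ) = ⌊α⌋ + 1) (b : ℤ) (f : ℤ → ℝ) (t : ℤ) (ht : t ≤ b - 1) :
    nablaRightSum b α
        (nablaRightSum b ((n : ℝ) - α) (fun s => (-1 : ℝ) ^ n * deltaOp^[n] f s)) t =
      f t - ∑ k ∈ Finset.range n,
          (Real.Gamma ((b : ℝ) - (t : ℝ) + (k : ℝ)) /
            (Real.Gamma ((b : ℝ) - (t : ℝ)) * (Nat.factorial k : ℝ))) * (negDeltaOp^[k] f) b ∧
      (α < 1 →
        nablaRightSum b α
            (nablaRightSum b ((n : ℝ) - α) (fun s => (-1 : ℝ) ^ n * deltaOp^[n] f s)) t =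
          f t - f b) := by
  have hlt : α < n := by
    rw [← Int.cast_natCast, hn, Int.cast_add, Int.cast_one]
    exact Int.lt_floor_add_one α
  refine ⟨nablaRightSum_caputo hα hlt b f ht, fun h1 => ?_⟩
  have hn1 : n = 1 := by
    have h0 : ⌊α⌋ = 0 := Int.floor_eq_zero_iff.mpr ⟨hα.le, h1⟩
    omega
  rw [nablaRightSum_caputo hα hlt b f ht, hn1]
  have hbt : (0 : ℝ) < (b : ℝ) - t := by
    rw [sub_pos, Int.cast_lt]
    omega
  simp [(Real.Gamma_pos_of_pos hbt).ne']
end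

section
/- Let α > 0 be a noninteger real number, n = ⌊α⌋ + 1, a ∈ ℤ, f : ℤ → ℝ, and t ∈ ℤ with t ≥ a + n. Then the delta left Caputo fractional difference evaluated at t − α coincides with the dual nabla left Caputo fractional difference based at a + n − 1 evaluated at t; explicitly, (1/Γ(n−α)) Σ_{s=a}^{t−n} [Γ(t−s−α)/Γ(t−s−n+1)]·(Δ^n f)(s) = (1/Γ(n−α)) Σ_{s=a+n}^{t} [Γ(t−s+n−α)/Γ(t−s+1)]·(∇^n f)(s). -/
theorem iterate_deltaOp_eq (n : ℕ) (f : ℤ → ℝ) (s : ℤ) :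
    (deltaOp^[n] f) s = (nablaOp^[n] f) (s + n) := by
  induction n generalizing s with
  | zero => simp
  | succ k ih =>
    rw [Function.iterate_succ_apply', Function.iterate_succ_apply']
    simp only [deltaOp, nablaOp, ih]
    push_cast
    congr 2 <;> ring_nf

theorem stmt13 (α : ℝ) (hα : 0 < α) (hαni : ∀ m : ℤ, α ≠ (m : ℝ)) (n : ℕ)
    (hn : (n : ℤ) = ⌊α⌋ + 1) (a : ℤ) (f : ℤ → ℝ) (t : ℤ) (ht : a + (n : ℤ) ≤ t) :
    (1 / Real.Gamma ((n : ℝ) - α)) * ∑ s ∈ Finset.Icc a (t - (n : ℤ)),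
        (Real.Gamma ((t : ℝ) - (s : ℝ) - α) / Real.Gamma ((t : ℝ) - (s : ℝ) - (n : ℝ) + 1)) *
          (deltaOp^[n] f) s =
      (1 / Real.Gamma ((n : ℝ) - α)) * ∑ s ∈ Finset.Icc (a + (n : ℤ)) t,
        (Real.Gamma ((t : ℝ) - (s : ℝ) + (n : ℝ) - α) / Real.Gamma ((t : ℝ) - (s : ℝ) + 1)) *
          (nablaOp^[n] f) s := by
  congr 1
  refine Finset.sum_bij (fun s _ => s + (n : ℤ)) ?_ ?_ ?_ ?_
  · intro s hs
    rw [Finset.mem_Icc] at hs ⊢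
    omega
  · intro s _ r _ h
    exact add_right_cancel h
  · intro s hs
    rw [Finset.mem_Icc] at hs
    exact ⟨s - n, by rw [Finset.mem_Icc]; omega, by ring⟩
  · intro s _
    rw [iterate_deltaOp_eq]
    push_cast
    congr 3 <;> ring_nf
end

section
/- Let α > 0 be real, a, b ∈ ℤ with a + 1 ≤ b − 1, and f, g : ℤ → ℝ. Then the summation by parts formula for fractional sums holds: Σ_{s=a+1}^{b−1} g(s)·(∇_a^{−α} f)(s) = Σ_{s=a+1}^{b−1} f(s)·(_b∇^{−α} g)(s). -/
theorem stmt14 (α : ℝ) (hα : 0 < α) (a b : ℤ) (hab : a + 1 ≤ b - 1) (f g : ℤ → ℝ) :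
    ∑ s ∈ Finset.Icc (a + 1) (b - 1), g s * nablaLeftSum a α f s =
      ∑ s ∈ Finset.Icc (a + 1) (b - 1), f s * nablaRightSum b α g s := by
  simp only [nablaLeftSum, nablaRightSum, Finset.mul_sum]
  rw [Finset.sum_comm' (t' := Finset.Icc (a + 1) (b - 1)) (s' := fun s => Finset.Icc s (b - 1))
    (by intro x y; simp only [Finset.mem_Icc]; lia)]
  refine Finset.sum_congr rfl fun s _ => Finset.sum_congr rfl fun t _ => ?_
  ring
end

section
/- Let α > 0 be a noninteger real number, n = ⌊α⌋ + 1, b ∈ ℤ, f : ℤ → ℝ, and t ∈ ℤ with t ≤ b − 1. Then (i) (_b∇^{α}(_b∇^{−α} f))(t) = f(t), and (ii) (_b∇^{−α}(_b∇^{α} f))(t) = f(t); that is, the nabla right Riemann fractional difference and the nabla right fractional sum of the same noninteger order α are two-sided inverses on {…, b−2, b−1}. -/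
/-- The power series whose `i`-th coefficient is `f (b - 1 - i)`. -/
noncomputable def reflectedSeries (b : ℤ) (f : ℤ → ℝ) : PowerSeries ℝ :=
  PowerSeries.mk fun i => f (b - 1 - i)

/-- The power series of `(1 - X) ^ (-α)`. -/
noncomputable def negPowSeries (α : ℝ) : PowerSeries ℝ :=
  PowerSeries.rescale (-1) (PowerSeries.binomialSeries ℝ (-α))

lemma negPowSeries_add (α β : ℝ) :
    negPowSeries (α + β) = negPowSeries α * negPowSeries β := by
  rw [negPowSeries, neg_add, PowerSeries.binomialSeries_add, map_mul]; rfl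

lemma negPowSeries_neg_natCast (n : ℕ) :
    negPowSeries (-(n : ℝ)) = (1 - PowerSeries.X) ^ n := by
  rw [negPowSeries, neg_neg, PowerSeries.binomialSeries_nat, map_pow, map_add, map_one,
    PowerSeries.rescale_X]
  simp [sub_eq_add_neg]

lemma coeff_succ_negPowSeries (α : ℝ) (k : ℕ) :
    ((k : ℝ) + 1) * PowerSeries.coeff (k + 1) (negPowSeries α) =
      (k + α) * PowerSeries.coeff k (negPowSeries α) := by
  have h := Ring.choose_eq_smul (a := -α) (n := k + 1)
  have h' := Ring.choose_eq_smul (a := -α) (n := k)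
  rw [descPochhammer_succ_right, Polynomial.smeval_mul, Nat.factorial_succ] at h
  simp only [negPowSeries, PowerSeries.coeff_rescale, PowerSeries.binomialSeries_coeff, h, h',
    smul_eq_mul, mul_one, Polynomial.smeval_sub, Polynomial.smeval_X, Polynomial.smeval_natCast,
    pow_zero, pow_succ, nsmul_eq_mul]
  push_cast
  field_simp
  ring

lemma Gamma_div_Gamma_eq_coeff_negPowSeries {α : ℝ} (hα : 0 < α) (k : ℕ) :
    1 / Real.Gamma α * (Real.Gamma (k + α) / Real.Gamma (k + 1)) =
      PowerSeries.coeff k (negPowSeries α) := by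
  induction k with
  | zero => simp [negPowSeries, (Real.Gamma_pos_of_pos hα).ne']
  | succ k ih =>
    have hk : (k : ℝ) + 1 ≠ 0 := by positivity
    have hka : (k : ℝ) + α ≠ 0 := by positivity
    apply mul_left_cancel₀ hk
    rw [coeff_succ_negPowSeries, ← ih]
    push_cast
    rw [Real.Gamma_add_one hk, show (k : ℝ) + 1 + α = k + α + 1 by ring, Real.Gamma_add_one hka]
    field_simp

lemma reflectedSeries_nablaRightSum (b : ℤ) {α : ℝ} (hα : 0 < α) (f : ℤ → ℝ) :
    reflectedSeries b (nablaRightSum b α f) = negPowSeries α * reflectedSeries b f := by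
  ext m
  rw [PowerSeries.coeff_mul, Finset.Nat.sum_antidiagonal_eq_sum_range_succ_mk, reflectedSeries,
    PowerSeries.coeff_mk, nablaRightSum, Finset.mul_sum]
  symm
  refine Finset.sum_bij (fun i _ => b - 1 - m + i) ?_ ?_ ?_ ?_
  · intro i hi
    simp only [Finset.mem_range, Finset.mem_Icc] at hi ⊢
    omega
  · intro i _ j _ hij
    omega
  · intro s hs
    simp only [Finset.mem_Icc] at hs
    exact ⟨(s - (b - 1 - m)).toNat, by simp only [Finset.mem_range]; omega, by omega⟩
  · intro i hi
    simp only [Finset.mem_range] at hi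
    have hcast : ((b - 1 - m + i : ℤ) : ℝ) - ((b - 1 - m : ℤ) : ℝ) = i := by push_cast; ring
    rw [hcast, ← mul_assoc, Gamma_div_Gamma_eq_coeff_negPowSeries hα, reflectedSeries,
      PowerSeries.coeff_mk]
    congr 2
    omega

lemma nablaRightSum_eq_zero {b t : ℤ} (ht : b ≤ t) (α : ℝ) (f : ℤ → ℝ) :
    nablaRightSum b α f t = 0 := by
  rw [nablaRightSum, Finset.Icc_eq_empty (by omega), Finset.sum_empty, mul_zero]

lemma reflectedSeries_deltaOp {b : ℤ} {g : ℤ → ℝ} (hg : g b = 0) :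
    reflectedSeries b (deltaOp g) = (PowerSeries.X - 1) * reflectedSeries b g := by
  ext m
  rw [sub_mul, one_mul, map_sub]
  cases m with
  | zero => simp [reflectedSeries, deltaOp, hg]
  | succ m =>
    rw [PowerSeries.coeff_succ_X_mul]
    simp only [reflectedSeries, deltaOp, PowerSeries.coeff_mk]
    congr 2
    push_cast
    ring

lemma reflectedSeries_iterate_deltaOp {b : ℤ} {g : ℤ → ℝ} (hg : ∀ t, b ≤ t → g t = 0) (n : ℕ) :
    reflectedSeries b (deltaOp^[n] g) = (PowerSeries.X - 1) ^ n * reflectedSeries b g := by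
  induction n generalizing g with
  | zero => simp
  | succ n ih =>
    have hdg : ∀ t, b ≤ t → deltaOp g t = 0 := fun t ht => by
      rw [deltaOp, hg t ht, hg (t + 1) (by omega), sub_zero]
    rw [Function.iterate_succ_apply, ih hdg, reflectedSeries_deltaOp (hg b le_rfl), pow_succ,
      mul_assoc]

/-- In terms of reflected series, the Riemann fractional difference of order `α` is
multiplication by `(1 - X) ^ α`. -/
lemma reflectedSeries_fractionalDifference (b : ℤ) {α : ℝ} {n : ℕ} (hn : α < n) (f : ℤ → ℝ) :
    reflectedSeries b
        (fun s => (-1 : ℝ) ^ n * deltaOp^[n] (nablaRightSum b ((n : ℝ) - α) f) s) =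
      negPowSeries (-α) * reflectedSeries b f := by
  have hsmul (g : ℤ → ℝ) : reflectedSeries b (fun s => (-1 : ℝ) ^ n * g s) =
      (-1) ^ n * reflectedSeries b g := by
    ext m
    rcases Nat.even_or_odd n with h' | h' <;> simp [reflectedSeries, h'.neg_one_pow]
  rw [hsmul, reflectedSeries_iterate_deltaOp fun t ht => nablaRightSum_eq_zero ht _ _,
    reflectedSeries_nablaRightSum b (sub_pos.2 hn), ← mul_assoc, ← mul_assoc, ← mul_pow,
    neg_one_mul, neg_sub, ← negPowSeries_neg_natCast, ← negPowSeries_add]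
  congr 2
  ring

lemma eq_of_reflectedSeries_eq {b t : ℤ} (ht : t ≤ b - 1) {f g : ℤ → ℝ}
    (h : reflectedSeries b f = reflectedSeries b g) : f t = g t := by
  have hc := congrArg (PowerSeries.coeff (b - 1 - t).toNat) h
  simp only [reflectedSeries, PowerSeries.coeff_mk] at hc
  rwa [show b - 1 - ((b - 1 - t).toNat : ℤ) = t by omega] at hc

theorem stmt16 (α : ℝ) (hα : 0 < α) (hαni : ∀ m : ℤ, α ≠ (m : ℝ)) (n : ℕ)
    (hn : (n : ℤ) = ⌊α⌋ + 1) (b : ℤ) (f : ℤ → ℝ) (t : ℤ) (ht : t ≤ b - 1) :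
    (-1 : ℝ) ^ n * deltaOp^[n] (nablaRightSum b ((n : ℝ) - α) (nablaRightSum b α f)) t = f t ∧
      nablaRightSum b α
          (fun s => (-1 : ℝ) ^ n * deltaOp^[n] (nablaRightSum b ((n : ℝ) - α) f) s) t =
        f t := by
  have hαn : α < n := by
    have h := Int.lt_floor_add_one α
    rw [← Int.cast_natCast, hn]
    exact_mod_cast h
  have hinv : negPowSeries (-α) * negPowSeries α = 1 := by
    rw [← negPowSeries_add, neg_add_cancel]
    simpa using negPowSeries_neg_natCast 0
  constructor
  · refine eq_of_reflectedSeries_eq (f := fun s => (-1 : ℝ) ^ n *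
      deltaOp^[n] (nablaRightSum b ((n : ℝ) - α) (nablaRightSum b α f)) s) ht ?_
    rw [reflectedSeries_fractionalDifference b hαn, reflectedSeries_nablaRightSum b hα,
      ← mul_assoc, hinv, one_mul]
  · refine eq_of_reflectedSeries_eq ht ?_
    rw [reflectedSeries_nablaRightSum b hα, reflectedSeries_fractionalDifference b hαn,
      ← mul_assoc, mul_comm (negPowSeries α), hinv, one_mul]
end

section
/- Let 0 < α < 1 be real, a, b ∈ ℤ with b ≥ a + 2, and f, g : ℤ → ℝ. Then the integration by parts formula for the nabla Caputo fractional difference holds: Σ_{s=a+1}^{b−1} g(s)·(^C∇_a^{α} f)(s) = f(b−1)·(_b∇^{−(1−α)} g)(b−1) − f(a)·(_b∇^{−(1−α)} g)(a) + Σ_{s=a}^{b−2} f(s)·(_b∇^{α} g)(s), where moreover (_b∇^{−(1−α)} g)(b−1) = g(b−1). -/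
/-- Left and right nabla fractional sums are adjoint to each other. -/
theorem sum_mul_nablaLeftSum (a b : ℤ) (α : ℝ) (f g : ℤ → ℝ) :
    ∑ s ∈ Finset.Icc (a + 1) (b - 1), g s * nablaLeftSum a α f s =
      ∑ s ∈ Finset.Icc (a + 1) (b - 1), f s * nablaRightSum b α g s := by
  simp only [nablaLeftSum, nablaRightSum, Finset.mul_sum]
  rw [Finset.sum_comm' (t' := Finset.Icc (a + 1) (b - 1)) (s' := fun r => Finset.Icc r (b - 1))
    (by intro x y; simp only [Finset.mem_Icc]; omega)]
  refine Finset.sum_congr rfl fun r _ => Finset.sum_congr rfl fun s _ => ?_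
  ring

/-- Summation by parts over an integer interval. -/
theorem sum_nablaOp_mul (f G : ℤ → ℝ) {a n : ℤ} (h : a ≤ n) :
    ∑ s ∈ Finset.Icc (a + 1) n, nablaOp f s * G s =
      f n * G n - f a * G a + ∑ s ∈ Finset.Icc a (n - 1), f s * negDeltaOp G s := by
  induction n, h using Int.leInduction with
  | base => simp
  | succ n hn ih =>
    have hl : Finset.Icc (a + 1) (n + 1) = insert (n + 1) (Finset.Icc (a + 1) n) := by
      ext x; simp only [Finset.mem_Icc, Finset.mem_insert]; omega
    have hr : Finset.Icc a n = insert n (Finset.Icc a (n - 1)) := by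
      ext x; simp only [Finset.mem_Icc, Finset.mem_insert]; omega
    rw [add_sub_cancel_right, hl, hr, Finset.sum_insert (by simp), Finset.sum_insert (by simp), ih]
    simp only [nablaOp, negDeltaOp, add_sub_cancel_right]
    ring

theorem nablaRightSum_sub_one (b : ℤ) {α : ℝ} (hα : 0 < α) (g : ℤ → ℝ) :
    nablaRightSum b α g (b - 1) = g (b - 1) := by
  have := (Real.Gamma_pos_of_pos hα).ne'
  simp [nablaRightSum, this]

theorem stmt18 (α : ℝ) (hα0 : 0 < α) (hα1 : α < 1) (a b : ℤ) (hab : a + 2 ≤ b)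
    (f g : ℤ → ℝ) :
    (∑ s ∈ Finset.Icc (a + 1) (b - 1), g s * nablaLeftSum a (1 - α) (nablaOp f) s =
        f (b - 1) * nablaRightSum b (1 - α) g (b - 1) - f a * nablaRightSum b (1 - α) g a +
          ∑ s ∈ Finset.Icc a (b - 2), f s * negDeltaOp (nablaRightSum b (1 - α) g) s) ∧
      nablaRightSum b (1 - α) g (b - 1) = g (b - 1) := by
  refine ⟨?_, nablaRightSum_sub_one b (sub_pos.2 hα1) g⟩
  rw [sum_mul_nablaLeftSum, sum_nablaOp_mul f _ (by omega : a ≤ b - 1),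
    show b - 1 - 1 = b - 2 by ring]
end

section
/- Let α > 0 be real, a, b ∈ ℤ, f : ℤ → ℝ, and define the reflection (Qf)(s) = f(a + b − s). Then for every integer t with t ≥ a, the Q-operator intertwines the nabla left and right fractional sums: (∇_a^{−α}(Qf))(t) = (_b∇^{−α} f)(a + b − t), i.e. ∇_a^{−α} Q f = Q(_b∇^{−α} f). -/
theorem stmt19 (α : ℝ) (hα : 0 < α) (a b : ℤ) (f : ℤ → ℝ) (t : ℤ) (ht : a ≤ t) :
    nablaLeftSum a α (fun s => f (a + b - s)) t = nablaRightSum b α f (a + b - t) := by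
  unfold nablaLeftSum nablaRightSum
  congr 1
  refine Finset.sum_nbij' (fun s => a + b - s) (fun s => a + b - s) ?_ ?_ ?_ ?_ ?_
  · intro s hs
    simp only [Finset.mem_Icc] at hs ⊢
    omega
  · intro s hs
    simp only [Finset.mem_Icc] at hs ⊢
    omega
  · intro s _
    ring
  · intro s _
    ring
  · intro s _
    have h : ((a + b - s : ℤ) : ℝ) - ((a + b - t : ℤ) : ℝ) = (t : ℝ) - s := by
      push_cast
      ring
    rw [h]
end
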